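/- For all integers 2 ≤ n < k < ∞, twice the Gromov–Hausdorff distance between S^n and S^k satisfies 2 d_GH(S^n, S^k) ≤ max{ arccos(−(k−1)/(k+1)), π − p_{k+1}(ℝP^n), 2 p_{k+1}(ℝP^n) }. -/

import Mathlib

open Real

noncomputable section

/-- Euclidean space ℝ^d. -/
abbrev Euc (d : ℕ) : Type := EuclideanSpace ℝ (Fin d)

/-- The unit sphere S^n = {x ∈ ℝ^{n+1} : ⟨x,x⟩ = 1}. -/
def usphere (n : ℕ) : Set (Euc (n+1)) := {x | @inner ℝ _ _ x x = (1:ℝ)}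

/-- The geodesic distance d(x,y) = arccos⟨x,y⟩. -/
def geoDist {d : ℕ} (x y : Euc d) : ℝ := Real.arccos (@inner ℝ _ _ x y)

/-- A correspondence between A ⊆ ℝ^{d₁} and B ⊆ ℝ^{d₂}: a relation R ⊆ A × B whose
coordinate projections to A and B are both surjective. -/
def IsCorrespondence {d₁ d₂ : ℕ} (A : Set (Euc d₁)) (B : Set (Euc d₂))
    (R : Set (Euc d₁ × Euc d₂)) : Prop :=
  (∀ z ∈ R, z.1 ∈ A ∧ z.2 ∈ B) ∧
  (∀ a ∈ A, ∃ b ∈ B, (a, b) ∈ R) ∧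
  (∀ b ∈ B, ∃ a ∈ A, (a, b) ∈ R)

/-- The distortion of a relation, with respect to the geodesic metrics:
dis(R) = sup |d(x,x') − d(y,y')| over (x,y), (x',y') ∈ R. -/
def distortion {d₁ d₂ : ℕ} (R : Set (Euc d₁ × Euc d₂)) : ℝ :=
  sSup {t | ∃ z ∈ R, ∃ w ∈ R, t = |geoDist z.1 w.1 - geoDist z.2 w.2|}

/-- Twice the Gromov–Hausdorff distance between S^n and S^k (geodesic metrics),
via the Kalton–Ostrovskii formula: the infimum of dis(R) over all correspondences R. -/
def twoGH (n k : ℕ) : ℝ :=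
  sInf {t | ∃ R : Set (Euc (n+1) × Euc (k+1)),
    IsCorrespondence (usphere n) (usphere k) R ∧ t = distortion R}

/-- The quotient metric on ℝP^n, expressed on unit vectors:
d([x],[y]) = min(arccos⟨x,y⟩, π − arccos⟨x,y⟩). -/
def projDist {d : ℕ} (x y : Euc d) : ℝ :=
  min (Real.arccos (@inner ℝ _ _ x y)) (π - Real.arccos (@inner ℝ _ _ x y))

/-- The packing number p_m(ℝP^n): the supremum of ε > 0 such that there exist m points
of ℝP^n (represented by unit vectors in S^n) with pairwise projective distances ≥ ε. -/
def packRP (m n : ℕ) : ℝ :=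
  sSup {ε : ℝ | 0 < ε ∧ ∃ x : Fin m → Euc (n+1),
    (∀ i, x i ∈ usphere n) ∧ ∀ i j, i ≠ j → ε ≤ projDist (x i) (x j)}

theorem mem_usphere_iff_norm {n : ℕ} {x : Euc (n + 1)} : x ∈ usphere n ↔ ‖x‖ = 1 := by
  change inner ℝ x x = (1 : ℝ) ↔ ‖x‖ = 1
  rw [real_inner_self_eq_norm_sq, pow_eq_one_iff_of_nonneg (norm_nonneg x) two_ne_zero]

theorem usphere_eq_sphere (n : ℕ) : usphere n = Metric.sphere 0 1 := by
  ext x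
  rw [mem_usphere_iff_norm, mem_sphere_zero_iff_norm]

theorem neg_mem_usphere {n : ℕ} {x : Euc (n + 1)} (hx : x ∈ usphere n) : -x ∈ usphere n := by
  rwa [mem_usphere_iff_norm, norm_neg, ← mem_usphere_iff_norm]

theorem geoDist_comm {d : ℕ} (x y : Euc d) : geoDist x y = geoDist y x := by
  rw [geoDist, geoDist, real_inner_comm]

theorem geoDist_nonneg {d : ℕ} (x y : Euc d) : 0 ≤ geoDist x y := Real.arccos_nonneg _

theorem geoDist_le_pi {d : ℕ} (x y : Euc d) : geoDist x y ≤ π := Real.arccos_le_pi _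

theorem geoDist_neg_left {d : ℕ} (x y : Euc d) : geoDist (-x) y = π - geoDist x y := by
  rw [geoDist, inner_neg_left, Real.arccos_neg, geoDist]

theorem geoDist_neg_right {d : ℕ} (x y : Euc d) : geoDist x (-y) = π - geoDist x y := by
  rw [geoDist, inner_neg_right, Real.arccos_neg, geoDist]

theorem geoDist_self {n : ℕ} {x : Euc (n + 1)} (hx : x ∈ usphere n) : geoDist x x = 0 := by
  rw [geoDist, show inner ℝ x x = (1 : ℝ) from hx, Real.arccos_one]

theorem geoDist_eq_angle {n : ℕ} {x y : Euc (n + 1)} (hx : x ∈ usphere n) (hy : y ∈ usphere n) :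
    geoDist x y = InnerProductGeometry.angle x y := by
  rw [mem_usphere_iff_norm] at hx hy
  rw [geoDist, InnerProductGeometry.angle, hx, hy, mul_one, div_one]

theorem geoDist_triangle {n : ℕ} {x y z : Euc (n + 1)} (hx : x ∈ usphere n) (hy : y ∈ usphere n)
    (hz : z ∈ usphere n) : geoDist x z ≤ geoDist x y + geoDist y z := by
  rw [geoDist_eq_angle hx hz, geoDist_eq_angle hx hy, geoDist_eq_angle hy hz]
  exact InnerProductGeometry.angle_le_angle_add_angle x y z

theorem projDist_eq_arccos_abs {d : ℕ} (x y : Euc d) :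
    projDist x y = Real.arccos |inner ℝ x y| := by
  rw [projDist, ← Real.arccos_neg, abs_eq_max_neg, Real.antitone_arccos.map_max]

theorem projDist_nonneg {d : ℕ} (x y : Euc d) : 0 ≤ projDist x y := by
  rw [projDist_eq_arccos_abs]
  exact Real.arccos_nonneg _

theorem projDist_comm {d : ℕ} (x y : Euc d) : projDist x y = projDist y x := by
  rw [projDist, projDist, real_inner_comm]

theorem projDist_le_pi_div_two {d : ℕ} (x y : Euc d) : projDist x y ≤ π / 2 := by
  rw [projDist_eq_arccos_abs]
  exact Real.arccos_le_pi_div_two.mpr (abs_nonneg _)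

theorem continuous_projDist {X : Type*} [TopologicalSpace X] {d : ℕ} {f g : X → Euc d}
    (hf : Continuous f) (hg : Continuous g) : Continuous fun x => projDist (f x) (g x) := by
  have h : Continuous fun x => Real.arccos (inner ℝ (f x) (g x)) :=
    Real.continuous_arccos.comp (hf.inner hg)
  exact h.min (continuous_const.sub h)

/-- The packing number is attained. -/
theorem exists_isMax_packing {m : ℕ} (hm : 2 ≤ m) (n : ℕ) :
    (∃ x : Fin m → Euc (n + 1), (∀ i, x i ∈ usphere n) ∧
      ∀ i j, i ≠ j → packRP m n ≤ projDist (x i) (x j)) ∧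
    ∀ x : Fin m → Euc (n + 1), (∀ i, x i ∈ usphere n) →
      ∃ i j, i ≠ j ∧ projDist (x i) (x j) ≤ packRP m n := by
  have hne : (Finset.univ.offDiag : Finset (Fin m × Fin m)).Nonempty :=
    ⟨(⟨0, by lia⟩, ⟨1, by lia⟩), by simp⟩
  let F : (Fin m → Euc (n + 1)) → ℝ := fun x =>
    Finset.univ.offDiag.inf' hne fun q => projDist (x q.1) (x q.2)
  have hF : Continuous F := by
    refine Continuous.finset_inf'_apply hne fun q _ => ?_
    exact continuous_projDist (continuous_apply q.1) (continuous_apply q.2)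
  have hle (x : Fin m → Euc (n + 1)) (ε : ℝ) :
      ε ≤ F x ↔ ∀ i j, i ≠ j → ε ≤ projDist (x i) (x j) := by
    simp [F, Finset.le_inf'_iff]
  have hK : IsCompact (Set.univ.pi fun _ : Fin m => usphere n) :=
    isCompact_univ_pi fun _ => by
      rw [usphere_eq_sphere]
      exact isCompact_sphere 0 1
  have hKne : (Set.univ.pi fun _ : Fin m => usphere n).Nonempty :=
    ⟨fun _ => EuclideanSpace.single 0 1, fun i _ => by simp [mem_usphere_iff_norm]⟩
  obtain ⟨x₀, hx₀, hmax⟩ := hK.exists_isMaxOn hKne hF.continuousOn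
  have hmem (x : Fin m → Euc (n + 1)) (hx : ∀ i, x i ∈ usphere n) : F x ≤ F x₀ :=
    hmax fun i _ => hx i
  have hF₀ : 0 ≤ F x₀ := (hle _ _).2 fun _ _ _ => projDist_nonneg _ _
  have hub : ∀ ε ∈ {ε : ℝ | 0 < ε ∧ ∃ x : Fin m → Euc (n + 1),
      (∀ i, x i ∈ usphere n) ∧ ∀ i j, i ≠ j → ε ≤ projDist (x i) (x j)}, ε ≤ F x₀ := by
    rintro ε ⟨-, x, hx, hε⟩
    exact ((hle x ε).2 hε).trans (hmem x hx)
  have heq : packRP m n = F x₀ := by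
    refine le_antisymm (Real.sSup_le hub hF₀) ?_
    rcases hF₀.eq_or_lt with h | h
    · rw [← h]
      exact Real.sSup_nonneg fun ε hε => hε.1.le
    · exact le_csSup ⟨F x₀, hub⟩ ⟨h, x₀, fun i => hx₀ i trivial, (hle _ _).1 le_rfl⟩
  rw [heq]
  refine ⟨⟨x₀, fun i => hx₀ i trivial, (hle _ _).1 le_rfl⟩, fun x hx => ?_⟩
  obtain ⟨q, hq, hqF⟩ := Finset.exists_mem_eq_inf' hne fun q => projDist (x q.1) (x q.2)
  exact ⟨q.1, q.2, (Finset.mem_offDiag.1 hq).2.2, hqF.symm.trans_le (hmem x hx)⟩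

/-- Some optimal packing of `ℝPⁿ` is also a covering by closed balls of the same radius: one that
realizes the packing number by as few pairs as possible. -/
theorem exists_packing_covering {m : ℕ} (hm : 2 ≤ m) (n : ℕ) :
    ∃ x : Fin m → Euc (n + 1), (∀ i, x i ∈ usphere n) ∧
      (∀ i j, i ≠ j → packRP m n ≤ projDist (x i) (x j)) ∧
      ∀ a ∈ usphere n, ∃ i, projDist a (x i) ≤ packRP m n := by
  classical
  obtain ⟨hex, htight⟩ := exists_isMax_packing hm n
  set p := packRP m n
  let T : (Fin m → Euc (n + 1)) → Finset (Fin m × Fin m) := fun x =>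
    {q | q.1 ≠ q.2 ∧ projDist (x q.1) (x q.2) ≤ p}
  let P : Set (Fin m → Euc (n + 1)) :=
    {x | (∀ i, x i ∈ usphere n) ∧ ∀ i j, i ≠ j → p ≤ projDist (x i) (x j)}
  have hP : P.Nonempty := hex
  set x := Function.argminOn (fun x => (T x).card) P hP
  have hxP : x ∈ P := Function.argminOn_mem _ _ hP
  refine ⟨x, hxP.1, hxP.2, fun a ha => ?_⟩
  by_contra! hfar
  obtain ⟨i, j, hij, hle⟩ := htight x hxP.1
  have hnew : Function.update x i a ∈ P := by
    refine ⟨fun l => ?_, fun l l' hl => ?_⟩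
    · by_cases h : l = i
      · simpa [h] using ha
      · simpa [h] using hxP.1 l
    · by_cases h : l = i
      · subst h
        simpa [hl.symm] using (hfar l').le
      · by_cases h' : l' = i
        · subst h'
          simpa [h, projDist_comm _ a] using (hfar l).le
        · simpa [h, h'] using hxP.2 l l' hl
  have hlt : T (Function.update x i a) ⊂ T x := by
    refine Finset.ssubset_iff_subset_ne.2 ⟨fun q hq => ?_, fun h => ?_⟩
    · simp only [T, Finset.mem_filter, Finset.mem_univ, true_and] at hq ⊢
      refine ⟨hq.1, ?_⟩
      by_cases h : q.1 = i
      · have h' : q.2 ≠ i := fun h' => hq.1 (h.trans h'.symm)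
        have := hq.2
        rw [h, Function.update_self, Function.update_of_ne h'] at this
        exact absurd this (hfar _).not_ge
      · by_cases h' : q.2 = i
        · have := hq.2
          rw [h', Function.update_self, Function.update_of_ne h, projDist_comm] at this
          exact absurd this (hfar _).not_ge
        · simpa [h, h'] using hq.2
    · have hmem : (i, j) ∈ T (Function.update x i a) := by
        rw [h]
        simpa [T] using ⟨hij, hle⟩
      simp only [T, Finset.mem_filter, Finset.mem_univ, true_and, Function.update_self,
        Function.update_of_ne hij.symm] at hmem
      exact absurd hmem.2 (hfar j).not_ge
  exact Function.not_lt_argminOn (fun x => (T x).card) P hnew (Finset.card_lt_card hlt)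

/-- The union of a relation with its image under the simultaneous antipodal map. -/
def oddHull {d₁ d₂ : ℕ} (R : Set (Euc d₁ × Euc d₂)) : Set (Euc d₁ × Euc d₂) :=
  {z | z ∈ R ∨ -z ∈ R}

theorem oddHull_distortion_le {d₁ d₂ : ℕ} {R : Set (Euc d₁ × Euc d₂)} {B : ℝ}
    (h : ∀ z ∈ R, ∀ w ∈ R, |geoDist z.1 w.1 - geoDist z.2 w.2| ≤ B) :
    ∀ z ∈ oddHull R, ∀ w ∈ oddHull R, |geoDist z.1 w.1 - geoDist z.2 w.2| ≤ B := by
  have hl (z w : Euc d₁ × Euc d₂) : |geoDist (-z).1 w.1 - geoDist (-z).2 w.2| =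
      |geoDist z.1 w.1 - geoDist z.2 w.2| := by
    rw [Prod.fst_neg, Prod.snd_neg, geoDist_neg_left, geoDist_neg_left, sub_sub_sub_cancel_left,
      abs_sub_comm]
  have hr (z w : Euc d₁ × Euc d₂) : |geoDist z.1 (-w).1 - geoDist z.2 (-w).2| =
      |geoDist z.1 w.1 - geoDist z.2 w.2| := by
    rw [Prod.fst_neg, Prod.snd_neg, geoDist_neg_right, geoDist_neg_right,
      sub_sub_sub_cancel_left, abs_sub_comm]
  rintro z (hz | hz) w (hw | hw)
  · exact h z hz w hw
  · simpa only [hr] using h z hz _ hw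
  · simpa only [hl] using h _ hz w hw
  · simpa only [hl, hr] using h _ hz _ hw

/-- The relation that pairs each `x i` with the Voronoi cell of the basis vector `e i` among the
vertices `± e j` of the cross-polytope, and each `e i` with the Voronoi cell of `x i` among the
points `± x j`. -/
def coneRel {n k : ℕ} (x : Fin (k + 1) → Euc (n + 1)) : Set (Euc (n + 1) × Euc (k + 1)) :=
  {z | ∃ i, z.1 = x i ∧ z.2 ∈ usphere k ∧ ∀ j, |z.2 j| ≤ z.2 i} ∪
  {z | ∃ i, z.2 = EuclideanSpace.single i 1 ∧ z.1 ∈ usphere n ∧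
    ∀ j, |(inner ℝ z.1 (x j) : ℝ)| ≤ inner ℝ z.1 (x i)}

theorem single_mem_usphere {k : ℕ} (i : Fin (k + 1)) :
    (EuclideanSpace.single i 1 : Euc (k + 1)) ∈ usphere k := by
  simp [mem_usphere_iff_norm]

theorem isCorrespondence_oddHull {n k : ℕ} (x : Fin (k + 1) → Euc (n + 1))
    (hx : ∀ i, x i ∈ usphere n) :
    IsCorrespondence (usphere n) (usphere k) (oddHull (coneRel x)) := by
  have hsub : ∀ z ∈ coneRel x, z.1 ∈ usphere n ∧ z.2 ∈ usphere k := by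
    rintro z (⟨i, h1, h2, -⟩ | ⟨i, h1, h2, -⟩)
    · exact ⟨h1 ▸ hx i, h2⟩
    · exact ⟨h2, h1 ▸ single_mem_usphere i⟩
  refine ⟨?_, fun a ha => ?_, fun b hb => ?_⟩
  · rintro z (hz | hz)
    · exact hsub z hz
    · have := hsub _ hz
      exact ⟨neg_neg z.1 ▸ neg_mem_usphere this.1, neg_neg z.2 ▸ neg_mem_usphere this.2⟩
  · obtain ⟨i, hi⟩ := Finite.exists_max fun j => |(inner ℝ a (x j) : ℝ)|
    rcases le_total 0 (inner ℝ a (x i) : ℝ) with h | h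
    · rw [abs_of_nonneg h] at hi
      exact ⟨_, single_mem_usphere i, Or.inl (Or.inr ⟨i, rfl, ha, hi⟩)⟩
    · rw [abs_of_nonpos h] at hi
      refine ⟨_, neg_mem_usphere (single_mem_usphere i),
        Or.inr (Or.inr ⟨i, neg_neg _, neg_mem_usphere ha, fun j => ?_⟩)⟩
      simpa [inner_neg_left] using hi j
  · obtain ⟨i, hi⟩ := Finite.exists_max fun j => |b j|
    rcases le_total 0 (b i) with h | h
    · rw [abs_of_nonneg h] at hi
      exact ⟨_, hx i, Or.inl (Or.inl ⟨i, rfl, hb, hi⟩)⟩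
    · rw [abs_of_nonpos h] at hi
      refine ⟨_, neg_mem_usphere (hx i),
        Or.inr (Or.inl ⟨i, neg_neg _, neg_mem_usphere hb, fun j => ?_⟩)⟩
      simpa using hi j

theorem sum_sq_eq_one {k : ℕ} {y : Euc (k + 1)} (hy : y ∈ usphere k) : ∑ j, y j ^ 2 = 1 := by
  rw [mem_usphere_iff_norm] at hy
  rw [← EuclideanSpace.real_norm_sq_eq, hy, one_pow]

theorem one_le_mul_sq_of_abs_le {k : ℕ} {y : Euc (k + 1)} {i : Fin (k + 1)} (hy : y ∈ usphere k)
    (h : ∀ j, |y j| ≤ y i) : 1 ≤ ((k : ℝ) + 1) * y i ^ 2 := by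
  calc 1 = ∑ j, y j ^ 2 := (sum_sq_eq_one hy).symm
    _ ≤ ∑ _j : Fin (k + 1), y i ^ 2 :=
        Finset.sum_le_sum fun j _ => sq_le_sq' (neg_le_of_abs_le (h j)) (le_of_abs_le (h j))
    _ = ((k : ℝ) + 1) * y i ^ 2 := by
      rw [Finset.sum_const, Finset.card_univ, Fintype.card_fin, nsmul_eq_mul, Nat.cast_add_one]

/-- A Voronoi cell of the vertices of the cross-polytope has diameter at most
`arccos (-(k - 1) / (k + 1))`. -/
theorem geoDist_le_of_abs_le {k : ℕ} {y z : Euc (k + 1)} {i : Fin (k + 1)} (hy : y ∈ usphere k)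
    (hz : z ∈ usphere k) (h : ∀ j, |y j| ≤ y i) (h' : ∀ j, |z j| ≤ z i) :
    geoDist y z ≤ Real.arccos (-((k : ℝ) - 1) / ((k : ℝ) + 1)) := by
  refine Real.antitone_arccos ?_
  have h1 := one_le_mul_sq_of_abs_le hy h
  have h2 := one_le_mul_sq_of_abs_le hz h'
  have hyi : 0 ≤ y i := (abs_nonneg _).trans (h i)
  have hzi : 0 ≤ z i := (abs_nonneg _).trans (h' i)
  have hk : (0 : ℝ) < (k : ℝ) + 1 := by positivity
  have hyz : 1 ≤ ((k : ℝ) + 1) * (y i * z i) := by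
    refine (one_le_sq_iff₀ (by positivity)).1 ?_
    calc (1 : ℝ) = 1 * 1 := (one_mul 1).symm
      _ ≤ (((k : ℝ) + 1) * y i ^ 2) * (((k : ℝ) + 1) * z i ^ 2) := by gcongr
      _ = (((k : ℝ) + 1) * (y i * z i)) ^ 2 := by ring
  have hnorm : (y i + z i) ^ 2 ≤ 2 + 2 * inner ℝ y z := by
    have hsum : ‖y + z‖ ^ 2 = 2 + 2 * inner ℝ y z := by
      rw [norm_add_sq_real, mem_usphere_iff_norm.1 hy, mem_usphere_iff_norm.1 hz]
      ring
    rw [← hsum, EuclideanSpace.real_norm_sq_eq]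
    exact Finset.single_le_sum (f := fun j => (y + z) j ^ 2) (fun j _ => sq_nonneg _)
      (Finset.mem_univ i)
  rw [div_le_iff₀ hk]
  nlinarith

theorem geoDist_single_of_abs_le {k : ℕ} {y : Euc (k + 1)} {i j : Fin (k + 1)} (hij : i ≠ j)
    (hy : y ∈ usphere k) (h : |y i| ≤ y j) :
    π / 4 ≤ geoDist y (EuclideanSpace.single i 1) ∧
      geoDist y (EuclideanSpace.single i 1) ≤ 3 * π / 4 := by
  have hsq : y i ^ 2 + y j ^ 2 ≤ 1 := by
    rw [← sum_sq_eq_one hy, ← Finset.sum_pair (f := fun l => y l ^ 2) hij]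
    exact Finset.sum_le_sum_of_subset_of_nonneg (Finset.subset_univ _) fun _ _ _ => sq_nonneg _
  have hle : y i ^ 2 ≤ y j ^ 2 := sq_le_sq' (neg_le_of_abs_le h) (le_of_abs_le h)
  have habs : |y i| ≤ √2 / 2 := by
    refine abs_le_of_sq_le_sq ?_ (by positivity)
    rw [div_pow, Real.sq_sqrt zero_le_two]
    linarith
  have hcos : Real.arccos (√2 / 2) = π / 4 := by
    rw [← Real.cos_pi_div_four]
    exact Real.arccos_cos (by positivity) (by linarith [Real.pi_pos])
  have hin : geoDist y (EuclideanSpace.single i 1) = Real.arccos (y i) := by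
    simp [geoDist, EuclideanSpace.inner_single_right]
  rw [hin]
  refine ⟨hcos ▸ Real.antitone_arccos (le_of_abs_le habs), ?_⟩
  have := Real.antitone_arccos (neg_le_of_abs_le habs)
  rw [Real.arccos_neg, hcos] at this
  linarith

/-- A point of the Voronoi cell of `u` among `± u, ± v` is at distance at least half of
`projDist u v` from both `v` and `-v`. -/
theorem geoDist_of_abs_inner_le {n : ℕ} {a u v : Euc (n + 1)} (ha : a ∈ usphere n)
    (hu : u ∈ usphere n) (hv : v ∈ usphere n)
    (h : |(inner ℝ a v : ℝ)| ≤ inner ℝ a u) :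
    projDist u v / 2 ≤ geoDist v a ∧ geoDist v a ≤ π - projDist u v / 2 := by
  have h1 : geoDist a u ≤ geoDist a v := Real.antitone_arccos (le_of_abs_le h)
  have h2 : geoDist a u ≤ geoDist a (-v) := Real.antitone_arccos <| by
    rw [inner_neg_right]
    linarith [neg_le_of_abs_le h]
  have h3 := geoDist_triangle hu ha hv
  have h4 := geoDist_triangle hu ha (neg_mem_usphere hv)
  rw [geoDist_neg_right, geoDist_neg_right] at h4
  rw [geoDist_neg_right] at h2
  have h5 : projDist u v ≤ geoDist u v := min_le_left _ _
  have h6 : projDist u v ≤ π - geoDist u v := min_le_right _ _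
  rw [geoDist_comm u a] at h3 h4
  rw [geoDist_comm v a]
  constructor <;> linarith

theorem geoDist_le_pi_div_two_of_nonneg {d : ℕ} {u v : Euc d} (h : 0 ≤ (inner ℝ u v : ℝ)) :
    geoDist u v ≤ π / 2 :=
  Real.arccos_le_pi_div_two.mpr h

theorem coneRel_distortion_le {n k : ℕ} {p : ℝ} (hk : 1 ≤ k) (x : Fin (k + 1) → Euc (n + 1))
    (hx : ∀ i, x i ∈ usphere n) (hsep : ∀ i j, i ≠ j → p ≤ projDist (x i) (x j))
    (hcov : ∀ a ∈ usphere n, ∃ i, projDist a (x i) ≤ p) :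
    ∀ z ∈ coneRel x, ∀ w ∈ coneRel x, |geoDist z.1 w.1 - geoDist z.2 w.2| ≤
      max (Real.arccos (-((k : ℝ) - 1) / ((k : ℝ) + 1))) (max (π - p) (2 * p)) := by
  have hp : p ≤ π / 2 :=
    (hsep ⟨0, by lia⟩ ⟨1, by lia⟩ (by simp)).trans (projDist_le_pi_div_two _ _)
  set B := max (Real.arccos (-((k : ℝ) - 1) / ((k : ℝ) + 1))) (max (π - p) (2 * p))
  have hB₁ : Real.arccos (-((k : ℝ) - 1) / ((k : ℝ) + 1)) ≤ B := le_max_left _ _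
  have hB₂ : π - p ≤ B := le_max_of_le_right (le_max_left _ _)
  have hB₃ : 2 * p ≤ B := le_max_of_le_right (le_max_right _ _)
  have hmixed : ∀ z w : Euc (n + 1) × Euc (k + 1), ∀ i j,
      (z.1 = x j ∧ z.2 ∈ usphere k ∧ ∀ l, |z.2 l| ≤ z.2 j) →
      (w.2 = EuclideanSpace.single i 1 ∧ w.1 ∈ usphere n ∧
        ∀ l, |(inner ℝ w.1 (x l) : ℝ)| ≤ inner ℝ w.1 (x i)) →
      |geoDist z.1 w.1 - geoDist z.2 w.2| ≤ B := by
    rintro ⟨_, y⟩ ⟨a, _⟩ i j ⟨rfl, hy, hyj⟩ ⟨rfl, ha, hai⟩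
    dsimp only at *
    by_cases hij : i = j
    · subst hij
      have h1 : geoDist (x i) a ≤ π / 2 := geoDist_le_pi_div_two_of_nonneg <| by
        rw [real_inner_comm]
        exact (abs_nonneg _).trans (hai i)
      have h2 : geoDist y (EuclideanSpace.single i 1) ≤ π / 2 :=
        geoDist_le_pi_div_two_of_nonneg <| by
          simpa [EuclideanSpace.inner_single_right] using (abs_nonneg _).trans (hyj i)
      have := geoDist_nonneg (x i) a
      have := geoDist_nonneg y (EuclideanSpace.single i 1)
      rw [abs_le]
      constructor <;> linarith
    · obtain ⟨h1, h2⟩ := geoDist_of_abs_inner_le ha (hx i) (hx j) (hai j)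
      obtain ⟨h3, h4⟩ := geoDist_single_of_abs_le hij hy (hyj i)
      have := hsep i j hij
      rw [abs_le]
      constructor <;> linarith
  have hradius : ∀ a ∈ usphere n, ∀ i, (∀ l, |(inner ℝ a (x l) : ℝ)| ≤ inner ℝ a (x i)) →
      geoDist a (x i) ≤ p := by
    intro a ha i hai
    obtain ⟨l, hl⟩ := hcov a ha
    rw [projDist_eq_arccos_abs] at hl
    exact (Real.antitone_arccos (hai l)).trans hl
  rintro z (⟨i, hz⟩ | ⟨i, hz⟩) w (⟨j, hw⟩ | ⟨j, hw⟩)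
  · obtain ⟨h1, hy, hyi⟩ := hz
    obtain ⟨h2, hy', hyj⟩ := hw
    rw [h1, h2]
    by_cases hij : i = j
    · subst hij
      rw [geoDist_self (hx i), zero_sub, abs_neg, abs_of_nonneg (geoDist_nonneg _ _)]
      exact (geoDist_le_of_abs_le hy hy' hyi hyj).trans hB₁
    · have h3 := (hsep i j hij).trans (min_le_left _ _)
      have h4 := (hsep i j hij).trans (min_le_right _ _)
      rw [← geoDist] at h3 h4
      have := geoDist_nonneg z.2 w.2
      have := geoDist_le_pi z.2 w.2
      rw [abs_le]
      constructor <;> linarith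
  · exact hmixed z w j i hz hw
  · rw [geoDist_comm z.1, geoDist_comm z.2]
    exact hmixed w z i j hw hz
  · obtain ⟨h1, ha, hai⟩ := hz
    obtain ⟨h2, ha', haj⟩ := hw
    rw [h1, h2]
    by_cases hij : i = j
    · subst hij
      rw [geoDist_self (single_mem_usphere i), sub_zero, abs_of_nonneg (geoDist_nonneg _ _)]
      have h3 := hradius _ ha i hai
      have h4 := hradius _ ha' i haj
      have h5 := geoDist_triangle ha (hx i) ha'
      rw [geoDist_comm (x i)] at h5
      linarith
    · have h3 : geoDist (EuclideanSpace.single i 1 : Euc (k + 1)) (EuclideanSpace.single j 1) =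
          π / 2 := by
        simp [geoDist, EuclideanSpace.inner_single_right, Ne.symm hij]
      rw [h3]
      have := geoDist_nonneg z.1 w.1
      have := geoDist_le_pi z.1 w.1
      rw [abs_le]
      constructor <;> linarith

/-- For all 2 ≤ n < k < ∞,
2 d_GH(S^n,S^k) ≤ max{arccos(−(k−1)/(k+1)), π − p_{k+1}(ℝP^n), 2 p_{k+1}(ℝP^n)}. -/
theorem two_dGH_le_packing (n k : ℕ) (hn : 2 ≤ n) (hnk : n < k) :
    twoGH n k ≤ max (Real.arccos (-((k : ℝ) - 1) / ((k : ℝ) + 1)))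
      (max (π - packRP (k+1) n) (2 * packRP (k+1) n)) := by
  set p := packRP (k + 1) n
  obtain ⟨x, hx, hsep, hcov⟩ := exists_packing_covering (m := k + 1) (by lia) n
  have hR := isCorrespondence_oddHull x hx
  have hB : 0 ≤ max (Real.arccos (-((k : ℝ) - 1) / ((k : ℝ) + 1))) (max (π - p) (2 * p)) :=
    le_max_of_le_left (Real.arccos_nonneg _)
  refine le_trans (csInf_le (a := distortion (oddHull (coneRel x))) ⟨0, ?_⟩ ⟨_, hR, rfl⟩) ?_
  · rintro _ ⟨R, -, rfl⟩
    refine Real.sSup_nonneg ?_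
    rintro _ ⟨z, -, w, -, rfl⟩
    exact abs_nonneg _
  · refine Real.sSup_le ?_ hB
    rintro _ ⟨z, hz, w, hw, rfl⟩
    refine oddHull_distortion_le (fun z hz w hw => ?_) z hz w hw
    exact coneRel_distortion_le (by lia) x hx hsep hcov z hz w hw
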